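/- Let x : [0,b] → H be absolutely continuous with (almost everywhere) derivative ẋ, and let B : H → H be L-Lipschitz. Then z = B ∘ x is absolutely continuous, differentiable almost everywhere, and ‖ż(t)‖ ≤ L‖ẋ(t)‖ for almost every t ∈ [0,b]. -/

import Mathlib

open MeasureTheory

theorem aux_norm_deriv_le {E F : Type*} [NormedAddCommGroup E] [NormedSpace ℝ E]
    [NormedAddCommGroup F] [NormedSpace ℝ F] {f : ℝ → E} {h : ℝ → F} {f' : E} {h' : F} {t C : ℝ}
    (hf : HasDerivAt f f' t) (hh : HasDerivAt h h' t)
    (hle : ∀ᶠ s in nhds t, ‖f s - f t‖ ≤ C * ‖h s - h t‖) : ‖f'‖ ≤ C * ‖h'‖ := by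
  have h1 := (hasDerivAt_iff_tendsto_slope.1 hf).norm
  have h2 := ((hasDerivAt_iff_tendsto_slope.1 hh).norm).const_mul C
  refine le_of_tendsto_of_tendsto h1 h2 ?_
  filter_upwards [hle.filter_mono nhdsWithin_le_nhds] with s hs
  simp only [slope, vsub_eq_sub, norm_smul]
  calc _ ≤ ‖(s - t)⁻¹‖ * (C * ‖h s - h t‖) := by gcongr
    _ = _ := by ring

theorem aux_ac {f G : ℝ → ℝ} {a b : ℝ} (hG : AbsolutelyContinuousOnInterval G a b)
    (h : ∀ s ∈ Set.uIcc a b, ∀ t ∈ Set.uIcc a b, |f s - f t| ≤ |G s - G t|) :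
    AbsolutelyContinuousOnInterval f a b := by
  unfold AbsolutelyContinuousOnInterval at *
  refine squeeze_zero' (Filter.Eventually.of_forall fun E => Finset.sum_nonneg fun i _ => dist_nonneg) ?_ hG
  refine Filter.Eventually.filter_mono inf_le_right ?_
  rw [Filter.eventually_principal]
  intro E hE
  refine Finset.sum_le_sum fun i hi => ?_
  simp only [Real.dist_eq]
  exact h _ (hE.1 i hi).1 _ (hE.1 i hi).2

theorem aux_countable {K ι : Type*} [NormedAddCommGroup K] [InnerProductSpace ℝ K]
    [TopologicalSpace.SeparableSpace K] {e : ι → K} (he : Orthonormal ℝ e) : Countable ι := by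
  refine Pairwise.countable_of_isOpen_disjoint (s := fun i => Metric.ball (e i) (1/2)) ?_
    (fun i => Metric.isOpen_ball) (fun i => ⟨e i, Metric.mem_ball_self (by norm_num)⟩)
  intro i j hij
  refine Metric.ball_disjoint_ball ?_
  have h1 : ‖e i - e j‖ ^ 2 = 2 := by
    rw [norm_sub_sq_real, he.1 i, he.1 j, he.2 hij]; norm_num
  rw [dist_eq_norm]
  nlinarith [norm_nonneg (e i - e j)]

theorem aux_sep {K : Type*} [NormedAddCommGroup K] [InnerProductSpace ℝ K] [CompleteSpace K]
    [TopologicalSpace.SeparableSpace K] {b : ℝ} (hb : 0 < b) (z : ℝ → K) (g : ℝ → ℝ)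
    (hg : IntervalIntegrable g volume 0 b)
    (h : ∀ s ∈ Set.Icc 0 b, ∀ t ∈ Set.Icc 0 b,
      ‖z s - z t‖ ≤ |(∫ u in (0:ℝ)..s, g u) - ∫ u in (0:ℝ)..t, g u|) :
    ∃ w : ℝ → K, IntegrableOn w (Set.Icc 0 b) ∧
      ∀ t ∈ Set.Icc (0 : ℝ) b, z t = z 0 + ∫ s in (0 : ℝ)..t, w s := by
  classical
  have huIcc : Set.uIcc 0 b = Set.Icc 0 b := Set.uIcc_of_le hb.le
  obtain ⟨W, e, -⟩ := exists_hilbertBasis ℝ K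
  have : Countable W := aux_countable e.orthonormal
  set G : ℝ → ℝ := fun s => ∫ u in (0:ℝ)..s, g u with hGdef
  have hGac : AbsolutelyContinuousOnInterval G 0 b :=
    hg.absolutelyContinuousOnInterval_intervalIntegral Set.left_mem_uIcc
  have hac : ∀ i, AbsolutelyContinuousOnInterval (fun t => inner ℝ (e i) (z t)) 0 b := by
    intro i
    refine aux_ac hGac fun s hs t ht => ?_
    rw [huIcc] at hs ht
    rw [← inner_sub_right]
    refine (abs_real_inner_le_norm _ _).trans ?_
    rw [e.orthonormal.1 i, one_mul]
    exact h s hs t ht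
  set d : W → ℝ → ℝ := fun i => deriv (fun t => inner ℝ (e i) (z t)) with hd
  -- pointwise bounds
  have hbd : ∀ᵐ t ∂volume.restrict (Set.Icc 0 b), ∀ F : Finset W,
      ‖∑ i ∈ F, d i t • e i‖ ≤ |g t| := by
    have h1 : ∀ᵐ t, ∀ i, t ∈ Set.uIcc 0 b → DifferentiableAt ℝ (fun t => inner ℝ (e i) (z t)) t :=
      ae_all_iff.2 fun i => (hac i).ae_differentiableAt
    have h2 := hg.ae_hasDerivAt_integral
    have h3 : ∀ᵐ t, t ∈ Set.Ioo 0 b ↔ t ∈ Set.Icc 0 b := Ioo_ae_eq_Icc.mem_iff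
    rw [ae_restrict_iff' measurableSet_Icc]
    filter_upwards [h1, h2, h3] with t h1 h2 h3 ht F
    have hto := h3.2 ht
    rw [huIcc] at h1 h2
    have hG' : HasDerivAt G (g t) t := h2 ht 0 ⟨le_rfl, hb.le⟩
    have hF : HasDerivAt (fun s => ∑ i ∈ F, inner ℝ (e i) (z s) • e i)
        (∑ i ∈ F, d i t • e i) t :=
      HasDerivAt.fun_sum fun i _ => ((h1 i ht).hasDerivAt).smul_const (e i)
    have := aux_norm_deriv_le (C := 1) hF hG' ?_
    · simpa using this
    filter_upwards [Ioo_mem_nhds hto.1 hto.2] with s hs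
    rw [one_mul, ← Finset.sum_sub_distrib]
    refine le_trans ?_ (h s (Set.Ioo_subset_Icc_self hs) t ht)
    simp only [← sub_smul, ← inner_sub_right]
    refine abs_le_of_sq_le_sq' ?_ (norm_nonneg _) |>.2
    rw [← real_inner_self_eq_norm_sq, e.orthonormal.inner_sum]
    refine le_trans (le_of_eq ?_) (e.orthonormal.sum_inner_products_le (z s - z t) (s := F))
    refine Finset.sum_congr rfl fun i _ => ?_
    simp [sq]
  have hsum : ∀ᵐ t ∂volume.restrict (Set.Icc 0 b), HasSum (fun i => d i t • e i) (∑' i, d i t • e i) := by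
    filter_upwards [hbd] with t ht
    refine Summable.hasSum ?_
    have := (e.orthonormal.orthogonalFamily).summable_iff_norm_sq_summable (fun i => d i t)
    simp only [LinearIsometry.toSpanSingleton_apply] at this
    rw [this]
    refine summable_of_sum_le (c := |g t| ^ 2) (fun i => by positivity) fun F => ?_
    refine le_trans (le_of_eq ?_) (pow_le_pow_left₀ (norm_nonneg _) (ht F) 2)
    rw [← real_inner_self_eq_norm_sq, e.orthonormal.inner_sum]
    refine Finset.sum_congr rfl fun i _ => ?_
    simp [sq]
  set w : ℝ → K := fun t => ∑' i, d i t • e i with hw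
  have hwm : AEStronglyMeasurable w (volume.restrict (Set.Icc 0 b)) := by
    refine aestronglyMeasurable_of_tendsto_ae (u := (Filter.atTop : Filter (Finset W)))
      (f := fun F t => ∑ i ∈ F, d i t • e i) (fun F => ?_) hsum
    refine Finset.aestronglyMeasurable_fun_sum _ fun i _ => ?_
    exact ((measurable_deriv _).aestronglyMeasurable).smul_const _
  have hgI : IntegrableOn g (Set.Icc 0 b) := by
    rw [integrableOn_Icc_iff_integrableOn_Ioc]
    exact (intervalIntegrable_iff_integrableOn_Ioc_of_le hb.le).1 hg
  have hwI : IntegrableOn w (Set.Icc 0 b) := by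
    refine Integrable.mono hgI hwm ?_
    filter_upwards [hbd, hsum] with t h1 h2
    exact le_of_tendsto h2.norm (Filter.Eventually.of_forall h1)
  refine ⟨w, hwI, fun t ht => ?_⟩
  have hsub : Set.uIcc 0 t ⊆ Set.uIcc 0 b := by
    rw [Set.uIcc_of_le ht.1, huIcc]; exact Set.Icc_subset_Icc_right ht.2
  have hwt : IntervalIntegrable w volume 0 t := by
    rw [intervalIntegrable_iff_integrableOn_Ioc_of_le ht.1]
    exact hwI.mono_set (Set.Ioc_subset_Icc_self.trans (Set.Icc_subset_Icc_right ht.2))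
  apply e.repr.injective
  ext i
  rw [e.repr_apply_apply, e.repr_apply_apply, inner_add_right]
  have h1 : inner ℝ (e i) (∫ s in (0:ℝ)..t, w s) = ∫ s in (0:ℝ)..t, inner ℝ (e i) (w s) :=
    ((innerSL ℝ (e i)).intervalIntegral_comp_comm hwt).symm
  have h2 : ∫ s in (0:ℝ)..t, inner ℝ (e i) (w s) = ∫ s in (0:ℝ)..t, d i s := by
    refine intervalIntegral.integral_congr_ae ?_
    have := (ae_restrict_iff' measurableSet_Icc).1 hsum
    filter_upwards [this] with s hs hst
    rw [Set.uIoc_of_le ht.1] at hst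
    have h3 := (hs ⟨hst.1.le, hst.2.trans ht.2⟩).mapL (innerSL ℝ (e i))
    refine h3.unique ?_
    have h4 := hasSum_ite_eq i (d i s)
    refine (congrArg (fun f => HasSum f (d i s)) (funext fun j => ?_)).mpr h4
    simp only [innerSL_apply_apply, inner_smul_right, orthonormal_iff_ite.1 e.orthonormal i j]
    by_cases hij : j = i
    · subst hij; simp
    · simp [hij, Ne.symm hij]
  rw [h1, h2, ((hac i).mono hsub).integral_deriv_eq_sub]
  ring

theorem lipschitz_comp_absolutely_continuous {H : Type*} [NormedAddCommGroup H]
    [InnerProductSpace ℝ H] [CompleteSpace H]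
    (b : ℝ) (hb : 0 < b) (x x' : ℝ → H)
    (hAC : ∃ y : ℝ → H, IntegrableOn y (Set.Icc 0 b) ∧
        ∀ t ∈ Set.Icc (0 : ℝ) b, x t = x 0 + ∫ s in (0 : ℝ)..t, y s)
    (hderiv : ∀ᵐ t ∂volume.restrict (Set.Icc (0 : ℝ) b), HasDerivAt x (x' t) t)
    (B : H → H) (L : ℝ) (hL : 0 ≤ L) (hBlip : ∀ u v : H, ‖B u - B v‖ ≤ L * ‖u - v‖) :
    ∃ z' : ℝ → H,
      (∃ w : ℝ → H, IntegrableOn w (Set.Icc 0 b) ∧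
          ∀ t ∈ Set.Icc (0 : ℝ) b, B (x t) = B (x 0) + ∫ s in (0 : ℝ)..t, w s) ∧
      (∀ᵐ t ∂volume.restrict (Set.Icc (0 : ℝ) b),
          HasDerivAt (fun s => B (x s)) (z' t) t ∧ ‖z' t‖ ≤ L * ‖x' t‖) := by
  obtain ⟨y, hyI, hxy⟩ := hAC
  have huIcc : Set.uIcc 0 b = Set.Icc 0 b := Set.uIcc_of_le hb.le
  have hsubI : ∀ s ∈ Set.Icc 0 b, ∀ t ∈ Set.Icc 0 b, IntervalIntegrable y volume s t := by
    intro s hs t ht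
    rw [intervalIntegrable_iff]
    refine hyI.mono_set (Set.uIoc_subset_uIcc.trans ?_)
    exact Set.uIcc_subset_Icc hs ht
  have h0 : (0:ℝ) ∈ Set.Icc 0 b := ⟨le_rfl, hb.le⟩
  have hb' : b ∈ Set.Icc 0 b := ⟨hb.le, le_rfl⟩
  set g : ℝ → ℝ := fun t => L * ‖y t‖ with hg
  have hgI : ∀ s ∈ Set.Icc 0 b, ∀ t ∈ Set.Icc 0 b, IntervalIntegrable g volume s t :=
    fun s hs t ht => (hsubI s hs t ht).norm.const_mul L
  have hle : ∀ s ∈ Set.Icc 0 b, ∀ t ∈ Set.Icc 0 b,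
      ‖B (x s) - B (x t)‖ ≤ |(∫ u in (0:ℝ)..s, g u) - ∫ u in (0:ℝ)..t, g u| := by
    intro s hs t ht
    refine (hBlip _ _).trans ?_
    rw [hxy s hs, hxy t ht, add_sub_add_left_eq_sub,
      intervalIntegral.integral_interval_sub_left (hsubI 0 h0 s hs) (hsubI 0 h0 t ht),
      intervalIntegral.integral_interval_sub_left (hgI 0 h0 s hs) (hgI 0 h0 t ht)]
    simp only [hg, intervalIntegral.integral_const_mul, abs_mul, abs_of_nonneg hL]
    gcongr
    exact intervalIntegral.norm_integral_le_abs_integral_norm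
  have hw : ∃ w : ℝ → H, IntegrableOn w (Set.Icc 0 b) ∧
          ∀ t ∈ Set.Icc (0 : ℝ) b, B (x t) = B (x 0) + ∫ s in (0 : ℝ)..t, w s := by
    have hxc : ContinuousOn x (Set.Icc 0 b) := by
      have := intervalIntegral.continuousOn_primitive_interval' (hsubI 0 h0 b hb') (huIcc ▸ h0)
      rw [huIcc] at this
      exact (continuousOn_const.add this).congr hxy
    have hBc : Continuous B :=
      (LipschitzWith.of_dist_le_mul (K := ⟨L, hL⟩) fun u v => by
        rw [dist_eq_norm, dist_eq_norm]; exact hBlip u v).continuous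
    have hzc : ContinuousOn (fun t => B (x t)) (Set.Icc 0 b) := hBc.comp_continuousOn hxc
    set S := (fun t => B (x t)) '' Set.Icc 0 b with hS
    have hSsep : TopologicalSpace.IsSeparable S := (isCompact_Icc.image_of_continuousOn hzc).isSeparable
    set K : Submodule ℝ H := (Submodule.span ℝ S).topologicalClosure with hK
    have hKsep : TopologicalSpace.IsSeparable (K : Set H) := by
      rw [hK, Submodule.topologicalClosure_coe]
      exact hSsep.span.closure
    have : TopologicalSpace.SeparableSpace K := hKsep.separableSpace
    have : CompleteSpace K := (Submodule.isClosed_topologicalClosure _).completeSpace_coe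
    have hmem : ∀ t ∈ Set.Icc 0 b, B (x t) ∈ K := fun t ht =>
      Submodule.le_topologicalClosure _ (Submodule.subset_span ⟨t, ht, rfl⟩)
    classical
    let zz : ℝ → K := fun t => if ht : t ∈ Set.Icc 0 b then ⟨B (x t), hmem t ht⟩ else 0
    have hzz : ∀ t ∈ Set.Icc 0 b, (zz t : H) = B (x t) := fun t ht => by
      simp only [zz, dif_pos ht]
    obtain ⟨w, hwI, hw⟩ := aux_sep hb zz g (hgI 0 h0 b hb') (fun s hs t ht => by
      rw [← Submodule.norm_coe, Submodule.coe_sub, hzz s hs, hzz t ht]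
      exact hle s hs t ht)
    refine ⟨fun t => (w t : H), K.subtypeL.integrable_comp hwI, fun t ht => ?_⟩
    have hwt : IntervalIntegrable w volume 0 t := by
      rw [intervalIntegrable_iff_integrableOn_Ioc_of_le ht.1]
      exact hwI.mono_set (Set.Ioc_subset_Icc_self.trans (Set.Icc_subset_Icc_right ht.2))
    have h1 := K.subtypeL.intervalIntegral_comp_comm hwt
    simp only [Submodule.subtypeL_apply] at h1
    rw [h1, ← hzz t ht, ← hzz 0 h0, ← Submodule.coe_add, ← hw t ht]
  obtain ⟨w, hwI, hw⟩ := hw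
  refine ⟨w, ⟨w, hwI, hw⟩, ?_⟩
  have hwi : IntervalIntegrable w volume 0 b := by
    rw [intervalIntegrable_iff_integrableOn_Ioc_of_le hb.le]
    exact hwI.mono_set Set.Ioc_subset_Icc_self
  have h3 : ∀ᵐ t, t ∈ Set.Ioo 0 b ↔ t ∈ Set.Icc 0 b := Ioo_ae_eq_Icc.mem_iff
  rw [ae_restrict_iff' measurableSet_Icc] at hderiv ⊢
  filter_upwards [hderiv, hwi.ae_hasDerivAt_integral, h3] with t h1 h2 h3 ht
  have hto := h3.2 ht
  rw [huIcc] at h2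
  have hz : HasDerivAt (fun s => B (x s)) (w t) t := by
    refine ((h2 ht 0 h0).const_add (B (x 0))).congr_of_eventuallyEq ?_
    filter_upwards [Ioo_mem_nhds hto.1 hto.2] with s hs
    exact hw s (Set.Ioo_subset_Icc_self hs)
  exact ⟨hz, aux_norm_deriv_le hz (h1 ht) (Filter.Eventually.of_forall fun s => hBlip _ _)⟩
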